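/- arXiv:1611.02251 — 2 statements merged into one kernel-verified Lean document; each statement's English description precedes it below -/
import Mathlib

section
/- For every m ≥ 1, every eigenvalue of −Δ_m lies in the interval [0, 4+√2). -/
open scoped BigOperators

noncomputable section

namespace VNLE

/-- `N_m = 2·5^m`, the number of points on the circle at level `m`. -/
def Nm (m : ℕ) : ℕ := 2 * 5 ^ m

/-- The partner of a vertex `n` of `K_m`: writing the representative `v` of `n`
(taking `v = 2·5^m` when `n = 0`) as `v = 5^k·a` with `5 ∤ a`, the partner is
`n + 5^k` if `a ≡ 1` or `3 (mod 5)`, and `n - 5^k` if `a ≡ 2` or `4 (mod 5)`.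
This realizes the identifications `5^k(1+5j) ∼ 5^k(2+5j)` and
`5^k(3+5j) ∼ 5^k(4+5j)` in `ℤ/(2·5^m)ℤ`. -/
def partner (m : ℕ) (n : ZMod (Nm m)) : ZMod (Nm m) :=
  let v : ℕ := if n.val = 0 then Nm m else n.val
  let k : ℕ := padicValNat 5 v
  if (v / 5 ^ k) % 5 = 1 ∨ (v / 5 ^ k) % 5 = 3 then n + ((5 ^ k : ℕ) : ZMod (Nm m))
  else n - ((5 ^ k : ℕ) : ZMod (Nm m))

/-- A function on `K_m`: a map on `ℤ/N_mℤ` constant on the identified pairs. -/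
def IsKFun (m : ℕ) (u : ZMod (Nm m) → ℝ) : Prop := ∀ n, u (partner m n) = u n

/-- The graph Laplacian `−Δ_m`. -/
def lap (m : ℕ) (u : ZMod (Nm m) → ℝ) : ZMod (Nm m) → ℝ := fun n =>
  4 * u n - u (n + 1) - u (n - 1) - u (partner m n + 1) - u (partner m n - 1)

/-- `u` is a `λ`-eigenfunction of `−Δ_m`. -/
def IsEigen (m : ℕ) (lam : ℝ) (u : ZMod (Nm m) → ℝ) : Prop :=
  IsKFun m u ∧ u ≠ 0 ∧ ∀ n, lap m u n = lam * u n

/-- The spectral decimation renormalization polynomial `R(x) = x(3−x)(5−x)`. -/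
def R (x : ℝ) : ℝ := x * (3 - x) * (5 - x)

/-- The `λ'`-extension of a function on `K_m` to a function on `K_{m+1}`. -/
def extFun (m : ℕ) (lam' : ℝ) (u : ZMod (Nm m) → ℝ) : ZMod (Nm (m + 1)) → ℝ := fun x =>
  let n : ZMod (Nm m) := ((x.val / 5 : ℕ) : ZMod (Nm m))
  if x.val % 5 = 0 then u n
  else if x.val % 5 = 1 ∨ x.val % 5 = 2 then
    ((2 - lam') * u n + u (n + 1)) / ((1 - lam') * (3 - lam'))
  else
    (u n + (2 - lam') * u (n + 1)) / ((1 - lam') * (3 - lam'))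

/-- Restriction of a function on `K_{m+1}` to the old vertices, giving a function on `K_m`. -/
def down (m : ℕ) (v : ZMod (Nm (m + 1)) → ℝ) : ZMod (Nm m) → ℝ := fun n =>
  v (((5 * n.val : ℕ) : ZMod (Nm (m + 1))))

/-- The Laplacian `−Δ_m` as a linear map. -/
def lapL (m : ℕ) : (ZMod (Nm m) → ℝ) →ₗ[ℝ] (ZMod (Nm m) → ℝ) where
  toFun := lap m
  map_add' u v := by funext n; simp only [lap, Pi.add_apply]; ring
  map_smul' c u := by funext n; simp only [lap, Pi.smul_apply, smul_eq_mul, RingHom.id_apply]; ring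

/-- The subspace of functions on `K_m` (maps constant on identified pairs). -/
def KFunSub (m : ℕ) : Submodule ℝ (ZMod (Nm m) → ℝ) where
  carrier := {u | IsKFun m u}
  add_mem' := by
    intro u v hu hv n
    simp only [Pi.add_apply, hu n, hv n]
  zero_mem' := fun _ => rfl
  smul_mem' := by
    intro c u hu n
    simp only [Pi.smul_apply, hu n]

/-- The `λ`-eigenspace of `−Δ_m` inside the space of functions on `K_m`. -/
def eigensp (m : ℕ) (lam : ℝ) : Submodule ℝ (ZMod (Nm m) → ℝ) :=
  LinearMap.ker (lapL m - lam • LinearMap.id) ⊓ KFunSub m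

/-- `c = (8 − √19)/3`, the smaller critical point of `R`. -/
def cpt : ℝ := (8 - Real.sqrt 19) / 3

/-- `φ₁`, the inverse of the (strictly increasing) restriction of `R` to `[0, c]`. -/
def phi1 : ℝ → ℝ := Function.invFunOn R (Set.Icc 0 cpt)

/-- Eigenvalue counting function: total dimension of the eigenspaces of `−Δ_m`
with eigenvalue `≤ t`. -/
def evCount (m : ℕ) (t : ℝ) : ℕ :=
  Module.finrank ℝ ↥(⨆ lam ∈ Set.Iic t, eigensp m lam)

/-- `evSorted m k = λ_k(m)`, the `k`-th smallest eigenvalue (with multiplicity,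
`1 ≤ k ≤ 5^m`) of `−Δ_m` acting on functions on `K_m`. -/
def evSorted (m k : ℕ) : ℝ := sInf {t : ℝ | k ≤ evCount m t}

/-- The restriction of a function on the circle `ℝ/ℤ` to the level-`m` vertices. -/
def restr (u : AddCircle (1 : ℝ) → ℝ) (m : ℕ) : ZMod (Nm m) → ℝ := fun n =>
  u (((n.val : ℝ) / (Nm m : ℝ) : ℝ) : AddCircle (1 : ℝ))

/-- A continuous function on the circle is admissible if at every level its values
agree on identified pairs, so that its restrictions are functions on `K_m`. -/
def Admissible (u : AddCircle (1 : ℝ) → ℝ) : Prop :=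
  Continuous u ∧ ∀ m, 1 ≤ m → ∀ n : ZMod (Nm m), restr u m (partner m n) = restr u m n

/-- `u` is a `λ`-eigenfunction of `−Δ` on `K`: it is admissible, nonzero, and
`sup_n |15^m (−Δ_m u_m)(n) − λ u(n/N_m)| → 0` as `m → ∞`. -/
def IsEigenK (lam : ℝ) (u : AddCircle (1 : ℝ) → ℝ) : Prop :=
  Admissible u ∧ u ≠ 0 ∧
    ∀ ε : ℝ, 0 < ε → ∃ M : ℕ, ∀ m, M ≤ m → ∀ n : ZMod (Nm m),
      |(15 : ℝ) ^ m * lap m (restr u m) n - lam * restr u m n| < ε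

/-- The symmetry-type subspace `V_{ε₁,ε₂}` of functions on `K_m`. -/
def symSub (m : ℕ) (e1 e2 : ℝ) : Submodule ℝ (ZMod (Nm m) → ℝ) where
  carrier := {u | IsKFun m u ∧ (∀ n, u (-n) = e1 * u n) ∧
    (∀ n, u (((5 ^ m : ℕ) : ZMod (Nm m)) - n) = e2 * u n)}
  add_mem' := by
    rintro u v ⟨hu, hu1, hu2⟩ ⟨hv, hv1, hv2⟩
    refine ⟨fun n => by simp only [Pi.add_apply, hu n, hv n],
      fun n => by simp only [Pi.add_apply, hu1 n, hv1 n]; ring,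
      fun n => by simp only [Pi.add_apply, hu2 n, hv2 n]; ring⟩
  zero_mem' := ⟨fun _ => rfl, fun n => by simp, fun n => by simp⟩
  smul_mem' := by
    rintro c u ⟨hu, hu1, hu2⟩
    refine ⟨fun n => by simp only [Pi.smul_apply, hu n],
      fun n => by simp only [Pi.smul_apply, smul_eq_mul, hu1 n]; ring,
      fun n => by simp only [Pi.smul_apply, smul_eq_mul, hu2 n]; ring⟩

instance (m : ℕ) : NeZero (Nm m) := ⟨by unfold Nm; positivity⟩

theorem Nm_succ (m : ℕ) : Nm (m + 1) = 5 * Nm m := by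
  unfold Nm; ring

theorem exists_natCast_lt (m : ℕ) (n : ZMod (Nm m)) : ∃ v : ℕ, v < Nm m ∧ n = (v : ZMod (Nm m)) :=
  ⟨n.val, n.val_lt, by simp⟩

theorem exists_natCast_pos_le (m : ℕ) (n : ZMod (Nm m)) :
    ∃ v : ℕ, 0 < v ∧ v ≤ Nm m ∧ n = (v : ZMod (Nm m)) := by
  by_cases h : n.val = 0
  · refine ⟨Nm m, NeZero.pos _, le_rfl, ?_⟩
    rw [ZMod.natCast_self]
    exact (ZMod.val_eq_zero n).1 h
  · exact ⟨n.val, Nat.pos_of_ne_zero h, n.val_lt.le, by simp⟩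

/-- The partner computed from the representative in `[1, N_m]`. -/
theorem partner_natCast (m v : ℕ) (hv : 0 < v) (hv' : v ≤ Nm m) :
    partner m (v : ZMod (Nm m)) =
      if (v / 5 ^ padicValNat 5 v) % 5 = 1 ∨ (v / 5 ^ padicValNat 5 v) % 5 = 3 then
        (v : ZMod (Nm m)) + ((5 ^ padicValNat 5 v : ℕ) : ZMod (Nm m))
      else (v : ZMod (Nm m)) - ((5 ^ padicValNat 5 v : ℕ) : ZMod (Nm m)) := by
  have key : (if (v : ZMod (Nm m)).val = 0 then Nm m else (v : ZMod (Nm m)).val) = v := by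
    rcases hv'.eq_or_lt with h | h
    · have h0 : (v : ZMod (Nm m)) = 0 := by rw [h, ZMod.natCast_self]
      rw [h0, ZMod.val_zero, if_pos rfl, h]
    · rw [ZMod.val_natCast_of_lt h, if_neg hv.ne']
  simp only [partner, key]

/-- Multiplication by `5`, the inclusion of the vertices of level `m` into those of level
`m + 1`. -/
def incl (m : ℕ) : ZMod (Nm m) →+ ZMod (Nm (m + 1)) :=
  ZMod.lift (Nm m) ⟨(AddMonoidHom.mulLeft (5 : ZMod (Nm (m + 1)))).comp
    (Int.castAddHom (ZMod (Nm (m + 1)))), by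
      have h : ((5 * Nm m : ℕ) : ZMod (Nm (m + 1))) = 0 := by
        rw [← Nm_succ, ZMod.natCast_self]
      simpa using h⟩

theorem incl_natCast (m v : ℕ) : incl m (v : ZMod (Nm m)) = ((5 * v : ℕ) : ZMod (Nm (m + 1))) := by
  rw [← Int.cast_natCast, incl, ZMod.lift_coe]
  simp

theorem incl_one (m : ℕ) : incl m 1 = 5 := by
  simpa using incl_natCast m 1

theorem exists_incl_add (m : ℕ) (x : ZMod (Nm (m + 1))) :
    ∃ n : ZMod (Nm m), x = incl m n ∨ x = incl m n + 1 ∨ x = incl m n + 2 ∨ x = incl m n + 3 ∨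
      x = incl m n + 4 := by
  obtain ⟨v, -, rfl⟩ := exists_natCast_lt _ x
  refine ⟨((v / 5 : ℕ) : ZMod (Nm m)), ?_⟩
  rw [incl_natCast]
  have h : v % 5 < 5 := Nat.mod_lt _ (by norm_num)
  have hv := Nat.div_add_mod v 5
  generalize v / 5 = w at *
  generalize v % 5 = r at *
  subst hv
  interval_cases r <;> simp

theorem partner_incl (m : ℕ) (n : ZMod (Nm m)) :
    partner (m + 1) (incl m n) = incl m (partner m n) := by
  obtain ⟨v, hv, hv', rfl⟩ := exists_natCast_pos_le m n
  have hval : padicValNat 5 (5 * v) = padicValNat 5 v + 1 := by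
    have : Fact (Nat.Prime 5) := ⟨by norm_num⟩
    rw [padicValNat.mul (by norm_num) hv.ne', padicValNat_self, add_comm]
  rw [incl_natCast, partner_natCast _ _ (by positivity) (by rw [Nm_succ]; gcongr), hval,
    partner_natCast m v hv hv', pow_succ', Nat.mul_div_mul_left _ _ (by norm_num)]
  split_ifs
  · rw [map_add, incl_natCast, incl_natCast]
  · rw [map_sub, incl_natCast, incl_natCast]

theorem partner_incl_add (m : ℕ) (n : ZMod (Nm m)) (r : ℕ) (hr : 0 < r) (hr' : r < 5) :
    partner (m + 1) (incl m n + r) =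
      if r = 1 ∨ r = 3 then incl m n + r + 1 else incl m n + r - 1 := by
  obtain ⟨v, hv, rfl⟩ := exists_natCast_lt m n
  have hval : padicValNat 5 (5 * v + r) = 0 :=
    padicValNat.eq_zero_of_not_dvd (by omega)
  have hN := Nm_succ m
  have hmod : (5 * v + r) % 5 = r := by omega
  rw [incl_natCast, ← Nat.cast_add, partner_natCast _ _ (by omega) (by omega), hval]
  simp [hmod]

section Decimation

variable {m : ℕ} {lam : ℝ} {v : ZMod (Nm (m + 1)) → ℝ}

theorem IsEigen.apply_add_two (hv : IsEigen (m + 1) lam v) (n : ZMod (Nm m)) :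
    v (incl m n + 2) = v (incl m n + 1) := by
  have h := hv.1 (incl m n + 1)
  have hp := partner_incl_add m n 1 (by norm_num) (by norm_num)
  norm_num [add_assoc] at hp
  rwa [hp] at h

theorem IsEigen.apply_add_four (hv : IsEigen (m + 1) lam v) (n : ZMod (Nm m)) :
    v (incl m n + 4) = v (incl m n + 3) := by
  have h := hv.1 (incl m n + 3)
  have hp := partner_incl_add m n 3 (by norm_num) (by norm_num)
  norm_num [add_assoc] at hp
  rwa [hp] at h

theorem IsEigen.eq_left (hv : IsEigen (m + 1) lam v) (n : ZMod (Nm m)) :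
    (2 - lam) * v (incl m n + 1) - v (incl m n + 3) = v (incl m n) := by
  have h := hv.2.2 (incl m n + 1)
  have hp := partner_incl_add m n 1 (by norm_num) (by norm_num)
  norm_num [add_assoc] at hp
  have e1 : incl m n + 2 + 1 = incl m n + 3 := by ring
  have e2 : incl m n + 2 - 1 = incl m n + 1 := by ring
  have e3 : incl m n + 1 + 1 = incl m n + 2 := by ring
  have e4 : incl m n + 1 - 1 = incl m n := by ring
  rw [lap, hp, e1, e2, e3, e4, hv.apply_add_two] at h
  linarith

theorem IsEigen.eq_right (hv : IsEigen (m + 1) lam v) (n : ZMod (Nm m)) :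
    (2 - lam) * v (incl m n + 3) - v (incl m n + 1) = v (incl m (n + 1)) := by
  have h := hv.2.2 (incl m n + 3)
  have hp := partner_incl_add m n 3 (by norm_num) (by norm_num)
  norm_num [add_assoc] at hp
  have e1 : incl m n + 4 + 1 = incl m (n + 1) := by rw [map_add, incl_one]; ring
  have e2 : incl m n + 4 - 1 = incl m n + 3 := by ring
  have e3 : incl m n + 3 + 1 = incl m n + 4 := by ring
  have e4 : incl m n + 3 - 1 = incl m n + 2 := by ring
  rw [lap, hp, e1, e2, e3, e4, hv.apply_add_two, hv.apply_add_four] at h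
  linarith

theorem IsEigen.mul_apply_add_one (hv : IsEigen (m + 1) lam v) (n : ZMod (Nm m)) :
    (1 - lam) * (3 - lam) * v (incl m n + 1) =
      (2 - lam) * v (incl m n) + v (incl m (n + 1)) := by
  linear_combination (2 - lam) * hv.eq_left n + hv.eq_right n

theorem IsEigen.mul_apply_add_three (hv : IsEigen (m + 1) lam v) (n : ZMod (Nm m)) :
    (1 - lam) * (3 - lam) * v (incl m n + 3) =
      v (incl m n) + (2 - lam) * v (incl m (n + 1)) := by
  linear_combination hv.eq_left n + (2 - lam) * hv.eq_right n

theorem IsEigen.mul_apply_sub_one (hv : IsEigen (m + 1) lam v) (n : ZMod (Nm m)) :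
    (1 - lam) * (3 - lam) * v (incl m n - 1) =
      v (incl m (n - 1)) + (2 - lam) * v (incl m n) := by
  have h := hv.mul_apply_add_three (n - 1)
  have e : incl m (n - 1) + 4 = incl m n - 1 := by rw [map_sub, incl_one]; ring
  rwa [← hv.apply_add_four, e, sub_add_cancel] at h

/-- Spectral decimation: away from the exceptional values `1` and `3`, an eigenfunction of level
`m + 1` restricts to an eigenfunction of level `m`. -/
theorem IsEigen.restrict (hv : IsEigen (m + 1) lam v) (h1 : lam ≠ 1) (h3 : lam ≠ 3) :
    IsEigen m (R lam) (fun n => v (incl m n)) := by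
  have hD : (1 - lam) * (3 - lam) ≠ 0 :=
    mul_ne_zero (sub_ne_zero.2 h1.symm) (sub_ne_zero.2 h3.symm)
  refine ⟨fun n => ?_, fun h0 => hv.2.1 ?_, fun n => ?_⟩
  · simp only [← partner_incl]
    exact hv.1 _
  · have hz (n : ZMod (Nm m)) : v (incl m n) = 0 := congrFun h0 n
    have hb (n : ZMod (Nm m)) : v (incl m n + 1) = 0 := by
      have h := hv.mul_apply_add_one n
      rw [hz, hz] at h
      exact (mul_eq_zero.1 (h.trans (by ring))).resolve_left hD
    have hc (n : ZMod (Nm m)) : v (incl m n + 3) = 0 := by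
      have h := hv.mul_apply_add_three n
      rw [hz, hz] at h
      exact (mul_eq_zero.1 (h.trans (by ring))).resolve_left hD
    funext x
    obtain ⟨n, rfl | rfl | rfl | rfl | rfl⟩ := exists_incl_add m x
    · exact hz n
    · exact hb n
    · exact (hv.apply_add_two n).trans (hb n)
    · exact hc n
    · exact (hv.apply_add_four n).trans (hc n)
  · have h := hv.2.2 (incl m n)
    have hu : v (incl m (partner m n)) = v (incl m n) := by
      rw [← partner_incl]
      exact hv.1 _
    have b1 := hv.mul_apply_add_one n
    have b2 := hv.mul_apply_sub_one n
    have b3 := hv.mul_apply_add_one (partner m n)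
    have b4 := hv.mul_apply_sub_one (partner m n)
    rw [hu] at b3 b4
    rw [lap, partner_incl] at h
    simp only [lap, R]
    linear_combination ((1 - lam) * (3 - lam)) * h + b1 + b2 + b3 + b4

end Decimation

theorem IsEigen.nonneg {m : ℕ} {lam : ℝ} {u : ZMod (Nm m) → ℝ} (hu : IsEigen m lam u) :
    0 ≤ lam := by
  obtain ⟨x, hx⟩ := Function.ne_iff.1 hu.2.1
  obtain ⟨n, hn⟩ := Finite.exists_max (fun n => |u n|)
  have hpos : 0 < |u n| := (abs_pos.2 hx).trans_le (hn x)
  have hle (k : ZMod (Nm m)) : u n * u k ≤ u n * u n :=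
    (le_abs_self _).trans <| by
      rw [abs_mul, ← abs_mul_abs_self (u n)]
      exact mul_le_mul_of_nonneg_left (hn k) (abs_nonneg _)
  have h := hu.2.2 n
  rw [lap] at h
  have hsq : 0 < u n * u n := mul_self_pos.2 (abs_pos.1 hpos)
  refine nonneg_of_mul_nonneg_left (b := u n * u n) ?_ hsq
  have e : lam * (u n * u n) = u n * (lam * u n) := by ring
  rw [e, ← h]
  linarith [hle (n + 1), hle (n - 1), hle (partner m n + 1), hle (partner m n - 1)]

theorem IsEigen.eq_zero_of_level_zero {lam : ℝ} {u : ZMod (Nm 0) → ℝ} (hu : IsEigen 0 lam u) :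
    lam = 0 := by
  have hN : Nm 0 = 2 := by norm_num [Nm]
  have h2 : (2 : ZMod (Nm 0)) = 0 := by
    have h := ZMod.natCast_self (Nm 0)
    rw [hN] at h
    exact_mod_cast h
  have hp : partner 0 1 = 0 := by
    have h := partner_natCast 0 1 one_pos (by rw [hN]; norm_num)
    norm_num [h2, one_add_one_eq_two] at h
    exact h
  have h01 : u 0 = u 1 := hp ▸ hu.1 1
  have hconst (n : ZMod (Nm 0)) : u n = u 0 := by
    obtain ⟨w, hw, rfl⟩ := exists_natCast_lt 0 n
    rw [hN] at hw
    interval_cases w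
    · simp
    · simp [h01]
  have h0 : u 0 ≠ 0 := fun h0 => hu.2.1 (funext fun n => (hconst n).trans h0)
  have h := hu.2.2 0
  simp only [lap] at h
  rw [hconst (0 + 1), hconst (0 - 1), hconst (partner 0 0 + 1), hconst (partner 0 0 - 1)] at h
  exact (mul_eq_zero.1 (h.symm.trans (by ring))).resolve_right h0

/-- `4 + √2` is a fixed point of `R`, and `R` does not decrease values to its right. -/
theorem le_R_of_le {x : ℝ} (hx : 4 + Real.sqrt 2 ≤ x) : x ≤ R x := by
  have hs : Real.sqrt 2 ^ 2 = 2 := Real.sq_sqrt (by norm_num)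
  have hs0 := Real.sqrt_nonneg 2
  have hq : 1 ≤ (3 - x) * (5 - x) := by nlinarith
  calc x = x * 1 := (mul_one x).symm
    _ ≤ x * ((3 - x) * (5 - x)) := mul_le_mul_of_nonneg_left hq (by linarith)
    _ = R x := by rw [R]; ring

theorem IsEigen.lt_four_add_sqrt_two {m : ℕ} {lam : ℝ} {u : ZMod (Nm m) → ℝ}
    (hu : IsEigen m lam u) : lam < 4 + Real.sqrt 2 := by
  have hs0 := Real.sqrt_nonneg 2
  induction m generalizing lam with
  | zero =>
    rw [hu.eq_zero_of_level_zero]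
    positivity
  | succ m ih =>
    by_contra! hlam
    have h := ih (hu.restrict (by linarith) (by linarith))
    linarith [le_R_of_le hlam]

/-- Every eigenvalue of `−Δ_m` lies in `[0, 4 + √2)`. -/
theorem eigenvalues_in_range (m : ℕ) (hm : 1 ≤ m) (lam : ℝ)
    (u : ZMod (Nm m) → ℝ) (hu : IsEigen m lam u) :
    lam ∈ Set.Ico (0 : ℝ) (4 + Real.sqrt 2) := by
  exact ⟨hu.nonneg, hu.lt_four_add_sqrt_two⟩

end VNLE
end
end

section
/- There exists a constant M such that |f(x) − f(y)| ≤ M|x − y| for all x, y ∈ T; consequently f extends uniquely to a Lipschitz continuous function on [0,1]. -/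
open scoped BigOperators

noncomputable section

namespace VNLE

lemma cpt_lt : cpt < 1.22 := by
  have h : (4.35 : ℝ) < Real.sqrt 19 := Real.lt_sqrt_of_sq_lt (by norm_num)
  unfold cpt
  linarith

lemma one_le_cpt : 1 ≤ cpt := by
  have h : Real.sqrt 19 ≤ 5 := Real.sqrt_le_iff.mpr (by norm_num)
  unfold cpt
  linarith

lemma phi1_mem_and_R_phi1 {t : ℝ} (h0 : 0 ≤ t) (h8 : t ≤ 8) :
    phi1 t ∈ Set.Icc 0 cpt ∧ R (phi1 t) = t := by
  have hcont : ContinuousOn R (Set.Icc 0 1) := by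
    unfold R
    fun_prop
  have hmem : t ∈ Set.Icc (R 0) (R 1) := by
    constructor <;> norm_num [R] <;> linarith
  obtain ⟨y, hy, hyt⟩ := intermediate_value_Icc zero_le_one hcont hmem
  have hex : ∃ a ∈ Set.Icc 0 cpt, R a = t := ⟨y, ⟨hy.1, hy.2.trans one_le_cpt⟩, hyt⟩
  exact ⟨Function.invFunOn_mem hex, Function.invFunOn_eq hex⟩

/-- On `[0, 8)` the branch `φ₁` is nonnegative and contracts by a factor `8`. -/
lemma phi1_nonneg_and_le {t : ℝ} (h0 : 0 ≤ t) (h8 : t < 8) :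
    0 ≤ phi1 t ∧ phi1 t ≤ t / 8 := by
  obtain ⟨⟨hx0, hxc⟩, hR⟩ := phi1_mem_and_R_phi1 h0 h8.le
  generalize phi1 t = x at *
  have hc := cpt_lt
  unfold R at hR
  have hx1 : x < 1 := by
    by_contra! h
    have h2 : 0 ≤ x ^ 2 - 7 * x + 8 := by nlinarith
    nlinarith [mul_nonneg (sub_nonneg.mpr h) h2]
  refine ⟨hx0, ?_⟩
  have h3 : 8 ≤ (3 - x) * (5 - x) := by nlinarith
  nlinarith [mul_le_mul_of_nonneg_left h3 hx0]

lemma decimation_sequence_bound {a : ℕ → ℝ} (h0 : 0 ≤ a 0) (h6 : a 0 ≤ 6)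
    (h : ∀ k, a (k + 1) = phi1 (a k)) (k : ℕ) : 0 ≤ a k ∧ a k ≤ 6 / 8 ^ k := by
  induction k with
  | zero => simpa using ⟨h0, h6⟩
  | succ k ih =>
    have h1 : (6 : ℝ) / 8 ^ k ≤ 6 := div_le_self (by norm_num) (one_le_pow₀ (by norm_num))
    obtain ⟨h2, h3⟩ := phi1_nonneg_and_le ih.1 (by linarith)
    rw [h k]
    refine ⟨h2, h3.trans ?_⟩
    rw [pow_succ, ← div_div]
    linarith [ih.2]

/-- A property that persists when its bound is inflated by `1 + K / 2 ^ (k + 1)` at step `k`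
holds with one bound at all steps. -/
lemma uniform_bound_of_summable_growth {P : ℕ → ℝ → Prop} {K C : ℝ} (hK : 0 ≤ K) (hC : 0 ≤ C)
    (hmono : ∀ k a b, a ≤ b → P k a → P k b) (h0 : P 0 C)
    (hstep : ∀ k a, 0 ≤ a → P k a → P (k + 1) (a * (1 + K / 2 ^ (k + 1)))) (k : ℕ) :
    P k (C * Real.exp K) := by
  have key : ∀ k, P k (C * Real.exp (K - K / 2 ^ k)) := by
    intro k
    induction k with
    | zero => simpa using h0
    | succ k ih =>
      refine hmono _ _ _ ?_ (hstep k _ (by positivity) ih)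
      rw [mul_assoc]
      refine mul_le_mul_of_nonneg_left ?_ hC
      have h1 : K - K / 2 ^ (k + 1) = (K - K / 2 ^ k) + K / 2 ^ (k + 1) := by
        rw [pow_succ]; field_simp; ring
      rw [h1, Real.exp_add]
      gcongr
      linarith [Real.add_one_le_exp (K / 2 ^ (k + 1))]
  refine hmono _ _ _ ?_ (key k)
  gcongr
  have : 0 ≤ K / 2 ^ k := by positivity
  linarith

section LocalExtension

variable {x a b C : ℝ}

lemma extension_denominator_pos (hx : x ≤ 3 / 4) : 0 < (1 - x) * (3 - x) :=
  mul_pos (by linarith) (by linarith)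

lemma abs_extension_le (hx0 : 0 ≤ x) (hx : x ≤ 3 / 4) (ha : |a| ≤ C) (hb : |b| ≤ C) :
    |((2 - x) * a + b) / ((1 - x) * (3 - x))| ≤ C * (1 + 4 * x) := by
  have hden := extension_denominator_pos hx
  have hC : 0 ≤ C := (abs_nonneg a).trans ha
  rw [abs_div, abs_of_pos hden, div_le_iff₀ hden]
  calc |(2 - x) * a + b| ≤ (2 - x) * |a| + |b| := by
        refine (abs_add_le _ _).trans ?_
        rw [abs_mul, abs_of_nonneg (by linarith : 0 ≤ 2 - x)]
    _ ≤ (2 - x) * C + C := by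
        gcongr
        linarith
    _ = (3 - x) * C := by ring
    _ ≤ (3 - x) * (C * ((1 + 4 * x) * (1 - x))) := by
        have h : 1 ≤ (1 + 4 * x) * (1 - x) := by nlinarith
        have h3 : 0 ≤ 3 - x := by linarith
        gcongr
        exact le_mul_of_one_le_right hC h
    _ = C * (1 + 4 * x) * ((1 - x) * (3 - x)) := by ring

lemma three_div_extension_denominator_le (hx0 : 0 ≤ x) (hx : x ≤ 3 / 4) :
    3 / ((1 - x) * (3 - x)) ≤ 1 + 6 * x := by
  rw [div_le_iff₀ (extension_denominator_pos hx)]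
  nlinarith [mul_nonneg hx0 (sub_nonneg.mpr hx), mul_nonneg (mul_nonneg hx0 hx0) hx0,
    mul_nonneg (mul_nonneg hx0 hx0) (sub_nonneg.mpr hx),
    mul_nonneg hx0 (sq_nonneg (x - 3 / 4))]

/-- Bound for an end increment of the extension, in terms of the old increment `d`. -/
lemma abs_end_increment_le {d : ℝ} (hx0 : 0 ≤ x) (hx : x ≤ 3 / 4) (ha : |a| ≤ C) :
    3 * |(d + (3 * x - x ^ 2) * a) / ((1 - x) * (3 - x))| ≤
      (1 + 6 * x) * |d| + 18 * x * C := by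
  have hden := extension_denominator_pos hx
  have hC : 0 ≤ C := (abs_nonneg a).trans ha
  have h1 : |d + (3 * x - x ^ 2) * a| ≤ |d| + 3 * x * C := by
    refine (abs_add_le _ _).trans ?_
    rw [abs_mul, abs_of_nonneg (by nlinarith : 0 ≤ 3 * x - x ^ 2)]
    gcongr
    nlinarith
  have h3 := three_div_extension_denominator_le hx0 hx
  have hxC : 0 ≤ x * C := mul_nonneg hx0 hC
  calc 3 * |(d + (3 * x - x ^ 2) * a) / ((1 - x) * (3 - x))|
      = 3 / ((1 - x) * (3 - x)) * |d + (3 * x - x ^ 2) * a| := by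
        rw [abs_div, abs_of_pos hden]; ring
    _ ≤ (1 + 6 * x) * (|d| + 3 * x * C) := by gcongr
    _ ≤ (1 + 6 * x) * |d| + 18 * x * C := by nlinarith

lemma abs_left_increment_le (hx0 : 0 ≤ x) (hx : x ≤ 3 / 4) (ha : |a| ≤ C) :
    3 * |((2 - x) * a + b) / ((1 - x) * (3 - x)) - a| ≤
      (1 + 6 * x) * |b - a| + 18 * x * C := by
  have hden := (extension_denominator_pos hx).ne'
  convert abs_end_increment_le (d := b - a) hx0 hx ha using 3
  rw [div_sub' hden]
  ring

lemma abs_right_increment_le (hx0 : 0 ≤ x) (hx : x ≤ 3 / 4) (hb : |b| ≤ C) :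
    3 * |b - (a + (2 - x) * b) / ((1 - x) * (3 - x))| ≤
      (1 + 6 * x) * |b - a| + 18 * x * C := by
  have h := abs_left_increment_le (b := a) hx0 hx hb
  rwa [add_comm, abs_sub_comm, abs_sub_comm a b] at h

lemma abs_middle_increment_le (hx0 : 0 ≤ x) (hx : x ≤ 3 / 4) :
    3 * |(a + (2 - x) * b) / ((1 - x) * (3 - x)) - ((2 - x) * a + b) / ((1 - x) * (3 - x))| ≤
      (1 + 6 * x) * |b - a| := by
  have hden := extension_denominator_pos hx
  have h1 : (a + (2 - x) * b) / ((1 - x) * (3 - x)) - ((2 - x) * a + b) / ((1 - x) * (3 - x)) =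
      (1 - x) * (b - a) / ((1 - x) * (3 - x)) := by
    rw [← sub_div]
    ring
  rw [h1, abs_div, abs_mul, abs_of_pos hden, abs_of_nonneg (by linarith : 0 ≤ 1 - x)]
  calc 3 * ((1 - x) * |b - a| / ((1 - x) * (3 - x)))
      = (1 - x) * (3 / ((1 - x) * (3 - x)) * |b - a|) := by ring
    _ ≤ 1 * ((1 + 6 * x) * |b - a|) := by
        have h3 := three_div_extension_denominator_le hx0 hx
        gcongr
        linarith
    _ = (1 + 6 * x) * |b - a| := one_mul _

end LocalExtension

/-- `C` bounds a function `u` on `{0, …, N}` and its difference quotients at scale `1 / N`. -/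
def BoundsGrid (N : ℕ) (u : ℕ → ℝ) (C : ℝ) : Prop :=
  (∀ j ≤ N, |u j| ≤ C) ∧ ∀ j < N, N * |u (j + 1) - u j| ≤ C

lemma exists_boundsGrid (N : ℕ) (u : ℕ → ℝ) : ∃ C, 0 ≤ C ∧ BoundsGrid N u C := by
  set A := ∑ j ∈ Finset.range (N + 1), |u j|
  have hA : ∀ j ≤ N, |u j| ≤ A := fun j hj =>
    Finset.single_le_sum (f := fun j => |u j|) (fun _ _ => abs_nonneg _)
      (Finset.mem_range.mpr (by omega))
  have hA0 : 0 ≤ A := (abs_nonneg _).trans (hA 0 (Nat.zero_le _))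
  refine ⟨A + N * (2 * A), by positivity, fun j hj => (hA j hj).trans ?_, fun j hj => ?_⟩
  · have : 0 ≤ N * (2 * A) := by positivity
    linarith
  · have h1 : |u (j + 1) - u j| ≤ 2 * A := by
      linarith [abs_sub (u (j + 1)) (u j), hA j hj.le, hA (j + 1) hj]
    have := mul_le_mul_of_nonneg_left h1 (Nat.cast_nonneg (α := ℝ) N)
    linarith

/-- One extension step changes the grid bound by a factor `1 + 24 N x`. -/
lemma BoundsGrid.extend {N : ℕ} (hN : 1 ≤ N) {u v : ℕ → ℝ} {C x : ℝ} (h : BoundsGrid N u C)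
    (hx0 : 0 ≤ x) (hx : x ≤ 3 / 4) (hcons : ∀ j ≤ N, v (3 * j) = u j)
    (h1 : ∀ j < N, v (3 * j + 1) = ((2 - x) * u j + u (j + 1)) / ((1 - x) * (3 - x)))
    (h2 : ∀ j < N, v (3 * j + 2) = (u j + (2 - x) * u (j + 1)) / ((1 - x) * (3 - x))) :
    BoundsGrid (3 * N) v (C * (1 + 24 * N * x)) := by
  obtain ⟨hb, hd⟩ := h
  have hC : 0 ≤ C := (abs_nonneg _).trans (hb 0 (Nat.zero_le _))
  have hN1 : (1 : ℝ) ≤ N := by exact_mod_cast hN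
  have hCx : 0 ≤ C * x := mul_nonneg hC hx0
  have hCNx : C * x ≤ C * x * N := le_mul_of_one_le_right hCx hN1
  have hval : C * (1 + 4 * x) ≤ C * (1 + 24 * N * x) := by nlinarith
  have hinc : ∀ j < N, ∀ e : ℝ, 3 * |e| ≤ (1 + 6 * x) * |u (j + 1) - u j| + 18 * x * C →
      ((3 * N : ℕ) : ℝ) * |e| ≤ C * (1 + 24 * N * x) := by
    intro j hj e he
    have h3 := mul_le_mul_of_nonneg_left he (Nat.cast_nonneg (α := ℝ) N)
    have h4 := mul_le_mul_of_nonneg_left (hd j hj) (by linarith : 0 ≤ 1 + 6 * x)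
    push_cast
    nlinarith
  refine ⟨fun i hi => ?_, fun i hi => ?_⟩
  · obtain ⟨j, rfl | rfl | rfl⟩ : ∃ j, i = 3 * j ∨ i = 3 * j + 1 ∨ i = 3 * j + 2 :=
      ⟨i / 3, by omega⟩
    · rw [hcons j (by omega)]
      refine (hb j (by omega)).trans ?_
      nlinarith
    · rw [h1 j (by omega)]
      exact (abs_extension_le hx0 hx (hb j (by omega)) (hb (j + 1) (by omega))).trans hval
    · rw [h2 j (by omega), add_comm]
      exact (abs_extension_le hx0 hx (hb (j + 1) (by omega)) (hb j (by omega))).trans hval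
  · obtain ⟨j, rfl | rfl | rfl⟩ : ∃ j, i = 3 * j ∨ i = 3 * j + 1 ∨ i = 3 * j + 2 :=
      ⟨i / 3, by omega⟩
    · have hj : j < N := by omega
      rw [h1 j hj, hcons j hj.le]
      exact hinc j hj _ (abs_left_increment_le hx0 hx (hb j hj.le))
    · have hj : j < N := by omega
      rw [h2 j hj, h1 j hj]
      refine hinc j hj _ ((abs_middle_increment_le hx0 hx).trans ?_)
      nlinarith
    · have hj : j < N := by omega
      rw [h2 j hj, show 3 * j + 2 + 1 = 3 * (j + 1) by ring, hcons (j + 1) hj]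
      exact hinc j hj _ (abs_right_increment_le hx0 hx (hb (j + 1) hj))

lemma BoundsGrid.mono {N : ℕ} {u : ℕ → ℝ} {C C' : ℝ} (h : BoundsGrid N u C) (hC : C ≤ C') :
    BoundsGrid N u C' :=
  ⟨fun j hj => (h.1 j hj).trans hC, fun j hj => (h.2 j hj).trans hC⟩

lemma BoundsGrid.abs_sub_le_of_le {N : ℕ} {u : ℕ → ℝ} {C : ℝ} (h : BoundsGrid N u C) {i j : ℕ}
    (hij : i ≤ j) (hj : j ≤ N) : N * |u j - u i| ≤ C * ((j : ℝ) - i) := by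
  induction j, hij using Nat.le_induction with
  | base => simp
  | succ j hij ih =>
    have h1 := ih (by omega)
    have h2 := h.2 j (by omega)
    have h3 := mul_le_mul_of_nonneg_left (abs_sub_le (u (j + 1)) (u j) (u i))
      (Nat.cast_nonneg (α := ℝ) N)
    push_cast
    linarith

lemma BoundsGrid.abs_sub_le {N : ℕ} (hN : 0 < N) {u : ℕ → ℝ} {C : ℝ} (h : BoundsGrid N u C)
    {i j : ℕ} (hi : i ≤ N) (hj : j ≤ N) : |u i - u j| ≤ C * |(i : ℝ) / N - j / N| := by
  wlog hij : j ≤ i generalizing i j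
  · rw [abs_sub_comm, abs_sub_comm ((i : ℝ) / N)]
    exact this hj hi (by omega)
  have hN' : (0 : ℝ) < N := by exact_mod_cast hN
  have hij' : (j : ℝ) ≤ i := by exact_mod_cast hij
  rw [← sub_div, abs_of_nonneg (div_nonneg (sub_nonneg.mpr hij') hN'.le), ← mul_div_assoc,
    le_div_iff₀ hN', mul_comm]
  exact h.abs_sub_le_of_le hij hi

/-- If every level has the same grid bound and consecutive levels are compatible, the
resulting function on triadic points is Lipschitz. -/
lemma triadic_lipschitz {m₀ : ℕ} {f : ℕ → ℕ → ℝ} {M : ℝ}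
    (hcons : ∀ m, m₀ ≤ m → ∀ j, j < 3 ^ m → f (m + 1) (3 * j) = f m j)
    (hM : ∀ m, m₀ ≤ m → BoundsGrid (3 ^ m) (f m) M) {m m' j j' : ℕ} (hm : m₀ ≤ m)
    (hm' : m₀ ≤ m') (hj : j < 3 ^ m) (hj' : j' < 3 ^ m') :
    |f m j - f m' j'| ≤ M * |(j : ℝ) / 3 ^ m - (j' : ℝ) / 3 ^ m'| := by
  have lift : ∀ m j, m₀ ≤ m → j < 3 ^ m → ∀ k,
      3 ^ k * j < 3 ^ (m + k) ∧ f (m + k) (3 ^ k * j) = f m j := by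
    intro m j hm hj k
    induction k with
    | zero => simpa using hj
    | succ k ih =>
      have h1 : 3 ^ (k + 1) * j = 3 * (3 ^ k * j) := by ring
      refine ⟨?_, ?_⟩
      · rw [h1, ← add_assoc, pow_succ]
        omega
      · rw [h1, ← add_assoc, hcons _ (by omega) _ ih.1, ih.2]
  obtain ⟨h1, h2⟩ := lift m j hm hj m'
  obtain ⟨h3, h4⟩ := lift m' j' hm' hj' m
  rw [add_comm m' m] at h3 h4
  have h := (hM (m + m') (by omega)).abs_sub_le (by positivity) h1.le h3.le
  rw [h2, h4] at h
  convert h using 4 <;> push_cast <;> rw [pow_add] <;> field_simp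

/-- Triadic points at levels at least `m₀` approximate every point of `[0, 1]`. -/
lemma exists_triadic_tendsto (m₀ : ℕ) {x : ℝ} (hx : x ∈ Set.Icc (0 : ℝ) 1) :
    ∃ s : ℕ → ℕ, (∀ k, s k < 3 ^ (m₀ + k)) ∧
      Filter.Tendsto (fun k => (s k : ℝ) / 3 ^ (m₀ + k)) Filter.atTop (nhds x) := by
  have key : ∀ k : ℕ, ∃ i : ℕ, i < 3 ^ (m₀ + k) ∧
      |(i : ℝ) / 3 ^ (m₀ + k) - x| ≤ (1 / 3) ^ k := by
    intro k
    have hpos : (0 : ℝ) < 3 ^ (m₀ + k) := by positivity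
    have hle : (1 : ℝ) / 3 ^ (m₀ + k) ≤ (1 / 3) ^ k := by
      rw [one_div_pow]
      gcongr
      · norm_num
      · omega
    suffices h : ∃ i : ℕ, i < 3 ^ (m₀ + k) ∧
        |(i : ℝ) - x * 3 ^ (m₀ + k)| ≤ 1 by
      obtain ⟨i, hi, hi'⟩ := h
      refine ⟨i, hi, le_trans ?_ hle⟩
      rw [div_sub' hpos.ne', abs_div, abs_of_pos hpos, mul_comm]
      gcongr
    rcases hx.2.eq_or_lt with rfl | hx1
    · refine ⟨3 ^ (m₀ + k) - 1, Nat.sub_lt (by positivity) one_pos, ?_⟩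
      rw [Nat.cast_sub (Nat.one_le_pow _ _ (by norm_num))]
      norm_num
    · have h0 : 0 ≤ x * 3 ^ (m₀ + k) := mul_nonneg hx.1 hpos.le
      refine ⟨⌊x * 3 ^ (m₀ + k)⌋₊, ?_, ?_⟩
      · rw [Nat.floor_lt h0]
        push_cast
        exact mul_lt_of_lt_one_left hpos hx1
      · rw [abs_sub_le_iff]
        constructor <;> linarith [Nat.floor_le h0, Nat.lt_floor_add_one (x * 3 ^ (m₀ + k))]
  choose s hs hs' using key
  refine ⟨s, hs, ?_⟩
  rw [tendsto_iff_dist_tendsto_zero]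
  exact squeeze_zero (fun _ => dist_nonneg) hs'
    (tendsto_pow_atTop_nhds_zero_of_lt_one (by norm_num) (by norm_num))

lemma triadic_mem_Icc {m j : ℕ} (hj : j < 3 ^ m) : (j : ℝ) / 3 ^ m ∈ Set.Icc (0 : ℝ) 1 := by
  refine ⟨by positivity, div_le_one_of_le₀ ?_ (by positivity)⟩
  exact_mod_cast hj.le

lemma eqOn_of_triadic_eq {m₀ : ℕ} {g₁ g₂ : ℝ → ℝ} (h₁ : ContinuousOn g₁ (Set.Icc 0 1))
    (h₂ : ContinuousOn g₂ (Set.Icc 0 1))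
    (h : ∀ m j : ℕ, m₀ ≤ m → j < 3 ^ m → g₁ ((j : ℝ) / 3 ^ m) = g₂ ((j : ℝ) / 3 ^ m)) :
    Set.EqOn g₁ g₂ (Set.Icc 0 1) := by
  intro x hx
  obtain ⟨s, hs, hlim⟩ := exists_triadic_tendsto m₀ hx
  have hlim' := tendsto_nhdsWithin_iff.mpr
    ⟨hlim, Filter.Eventually.of_forall fun k => triadic_mem_Icc (hs k)⟩
  have t₁ := (h₁ x hx).tendsto.comp hlim'
  have t₂ := (h₂ x hx).tendsto.comp hlim'
  refine tendsto_nhds_unique t₁ (t₂.congr fun k => ?_)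
  exact (h _ _ (by omega) (hs k)).symm

lemma exists_lipschitz_extension {m₀ : ℕ} {f : ℕ → ℕ → ℝ} {M : ℝ} (hM : 0 ≤ M)
    (h : ∀ m m' j j', m₀ ≤ m → m₀ ≤ m' → j < 3 ^ m → j' < 3 ^ m' →
      |f m j - f m' j'| ≤ M * |(j : ℝ) / 3 ^ m - (j' : ℝ) / 3 ^ m'|) :
    ∃ g : ℝ → ℝ, LipschitzOnWith (Real.toNNReal M) g (Set.Icc 0 1) ∧
      ∀ m j : ℕ, m₀ ≤ m → j < 3 ^ m → g ((j : ℝ) / 3 ^ m) = f m j := by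
  have hF : ∀ x : ℝ, ∃ y : ℝ, ∀ m j : ℕ, m₀ ≤ m → j < 3 ^ m → (j : ℝ) / 3 ^ m = x →
      y = f m j := by
    intro x
    by_cases hx : ∃ m j : ℕ, m₀ ≤ m ∧ j < 3 ^ m ∧ (j : ℝ) / 3 ^ m = x
    · obtain ⟨m, j, hm, hj, rfl⟩ := hx
      refine ⟨f m j, fun m' j' hm' hj' he => ?_⟩
      have h1 := h m m' j j' hm hm' hj hj'
      rw [he, sub_self, abs_zero, mul_zero] at h1
      exact sub_eq_zero.mp (abs_nonpos_iff.mp h1)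
    · exact ⟨0, fun m j hm hj he => (hx ⟨m, j, hm, hj, he⟩).elim⟩
  choose F hF using hF
  have hlip : LipschitzOnWith (Real.toNNReal M) F
      {x | ∃ m j : ℕ, m₀ ≤ m ∧ j < 3 ^ m ∧ (j : ℝ) / 3 ^ m = x} := by
    refine LipschitzOnWith.of_dist_le_mul ?_
    rintro _ ⟨m, j, hm, hj, rfl⟩ _ ⟨m', j', hm', hj', rfl⟩
    rw [hF _ m j hm hj rfl, hF _ m' j' hm' hj' rfl, Real.dist_eq, Real.dist_eq,
      Real.coe_toNNReal _ hM]
    exact h m m' j j' hm hm' hj hj'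
  obtain ⟨g, hg, hgF⟩ := hlip.extend_real
  refine ⟨g, hg.lipschitzOnWith, fun m j hm hj => ?_⟩
  rw [← hgF ⟨m, j, hm, hj, rfl⟩]
  exact hF _ m j hm hj rfl

/-- The function `f` built on the triadic points by the extension
recursion is Lipschitz: `|f(x) − f(y)| ≤ M|x − y|` on `T`; consequently it extends
uniquely to a Lipschitz continuous function on `[0,1]`. -/
theorem restriction_is_lipschitz
    (m₀ : ℕ) (hm₀ : 1 ≤ m₀) (lam : ℕ → ℝ)
    (hlam0 : lam m₀ ∈ Set.Icc (0 : ℝ) (4 + Real.sqrt 2))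
    (hlam : ∀ m, m₀ ≤ m → lam (m + 1) = phi1 (lam m))
    (f : ℕ → ℕ → ℝ)
    (hwrap : ∀ m, m₀ ≤ m → f m (3 ^ m) = f m 0)
    (hcons : ∀ m, m₀ ≤ m → ∀ j, j < 3 ^ m → f (m + 1) (3 * j) = f m j)
    (hrec1 : ∀ m, m₀ ≤ m → ∀ j, j < 3 ^ m →
      f (m + 1) (3 * j + 1) =
        ((2 - lam (m + 1)) * f m j + f m (j + 1)) /
          ((1 - lam (m + 1)) * (3 - lam (m + 1))))
    (hrec2 : ∀ m, m₀ ≤ m → ∀ j, j < 3 ^ m →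
      f (m + 1) (3 * j + 2) =
        (f m j + (2 - lam (m + 1)) * f m (j + 1)) /
          ((1 - lam (m + 1)) * (3 - lam (m + 1)))) :
    ∃ M : ℝ, 0 ≤ M ∧
      (∀ m m' j j', m₀ ≤ m → m₀ ≤ m' → j < 3 ^ m → j' < 3 ^ m' →
        |f m j - f m' j'| ≤ M * |(j : ℝ) / 3 ^ m - (j' : ℝ) / 3 ^ m'|) ∧
      (∃ g : ℝ → ℝ, LipschitzOnWith (Real.toNNReal M) g (Set.Icc 0 1) ∧
        ∀ (m j : ℕ), m₀ ≤ m → j < 3 ^ m → g ((j : ℝ) / 3 ^ m) = f m j) ∧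
      (∀ g₁ g₂ : ℝ → ℝ, ContinuousOn g₁ (Set.Icc 0 1) → ContinuousOn g₂ (Set.Icc 0 1) →
        (∀ (m j : ℕ), m₀ ≤ m → j < 3 ^ m → g₁ ((j : ℝ) / 3 ^ m) = f m j) →
        (∀ (m j : ℕ), m₀ ≤ m → j < 3 ^ m → g₂ ((j : ℝ) / 3 ^ m) = f m j) →
        Set.EqOn g₁ g₂ (Set.Icc 0 1)) := by
  have hsqrt : Real.sqrt 2 ≤ 2 := Real.sqrt_le_iff.mpr (by norm_num)
  have hdecay := decimation_sequence_bound (a := fun k => lam (m₀ + k)) hlam0.1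
    (by simpa using hlam0.2.trans (by linarith)) (fun k => hlam (m₀ + k) (by omega))
  have hcons' : ∀ m, m₀ ≤ m → ∀ j ≤ 3 ^ m, f (m + 1) (3 * j) = f m j := by
    intro m hm j hj
    rcases hj.eq_or_lt with rfl | hj
    · rw [hwrap m hm, ← pow_succ', hwrap (m + 1) (by omega), ← hcons m hm 0 (by positivity)]
    · exact hcons m hm j hj
  obtain ⟨C, hC0, hC⟩ := exists_boundsGrid (3 ^ m₀) (f m₀)
  have hgrid := uniform_bound_of_summable_growth
    (P := fun k c => BoundsGrid (3 ^ (m₀ + k)) (f (m₀ + k)) c)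
    (K := 144 * 3 ^ m₀) (by positivity) hC0 (fun k a b hab h => h.mono hab) hC
    (fun k a ha h => by
      obtain ⟨hx0, hx⟩ := hdecay (k + 1)
      simp only [← add_assoc] at hx0 hx
      have hx' : lam (m₀ + k + 1) ≤ 3 / 4 := by
        refine hx.trans ?_
        rw [pow_succ, div_le_div_iff₀ (by positivity) (by norm_num)]
        have : (1 : ℝ) ≤ 8 ^ k := one_le_pow₀ (by norm_num)
        linarith
      have hm : m₀ ≤ m₀ + k := by omega
      have hext := h.extend (Nat.one_le_pow _ _ (by norm_num)) hx0 hx' (hcons' _ hm)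
        (hrec1 _ hm) (hrec2 _ hm)
      rw [← pow_succ'] at hext
      refine hext.mono (mul_le_mul_of_nonneg_left ?_ ha)
      have h34 : (3 : ℝ) ^ k ≤ 4 ^ (k + 1) :=
        (pow_le_pow_left₀ (by norm_num) (by norm_num) k).trans
          (pow_le_pow_right₀ (by norm_num) (by omega))
      have h8 : (8 : ℝ) ^ (k + 1) = 4 ^ (k + 1) * 2 ^ (k + 1) := by
        rw [← mul_pow]; norm_num
      push_cast
      calc 1 + 24 * (3 : ℝ) ^ (m₀ + k) * lam (m₀ + k + 1)
          ≤ 1 + 24 * (3 ^ m₀ * 4 ^ (k + 1)) * (6 / 8 ^ (k + 1)) := by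
            rw [pow_add]
            gcongr
        _ = 1 + 144 * 3 ^ m₀ / 2 ^ (k + 1) := by
            rw [h8]
            field_simp
            ring)
  have hlip := fun m m' j j' hm hm' hj hj' =>
    triadic_lipschitz (m := m) (m' := m') (j := j) (j' := j') hcons
      (fun n hn => by simpa [Nat.add_sub_cancel' hn] using hgrid (n - m₀)) hm hm' hj hj'
  have hM : 0 ≤ C * Real.exp (144 * 3 ^ m₀) := by positivity
  refine ⟨_, hM, hlip, exists_lipschitz_extension hM hlip, fun g₁ g₂ hg₁ hg₂ h₁ h₂ => ?_⟩
  exact eqOn_of_triadic_eq hg₁ hg₂ fun m j hm hj => (h₁ m j hm hj).trans (h₂ m j hm hj).symm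

end VNLE
end
end
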